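/- arXiv:2605.18079 — 2 statements merged into one kernel-verified Lean document; each statement's English description precedes it below -/
import Mathlib

section
/- Let s = (s_0,…,s_{n−1}) ∈ ℝ^n and let β = sep(s) be its separation. Then ‖hardmax(s) − softmax(s)‖₁ ≤ 2n·e^{−β}, where ‖x‖₁ = Σ_j |x_j|. -/
open Classical

/-- The softmax of a vector of scores. -/
noncomputable def softmax {n : ℕ} (s : Fin n → ℝ) : Fin n → ℝ :=
  fun j => Real.exp (s j) / ∑ l, Real.exp (s l)

/-- The set of indices attaining the maximal score. -/
def argmaxSet {n : ℕ} (s : Fin n → ℝ) : Set (Fin n) := {j | ∀ l, s l ≤ s j}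

/-- The (averaging) hardmax of a vector of scores: uniform weight on the maximizers. -/
noncomputable def hardmax {n : ℕ} (s : Fin n → ℝ) : Fin n → ℝ :=
  fun j => if j ∈ argmaxSet s then 1 / ((argmaxSet s).ncard : ℝ) else 0

/-- The separation of the scores: the minimum over the argmax set minus the maximum over
its complement (only meaningful when the complement is nonempty; when empty the
separation is `+∞`). -/
noncomputable def sepScore {n : ℕ} (s : Fin n → ℝ) : ℝ :=
  sInf (s '' argmaxSet s) - sSup (s '' (argmaxSet s)ᶜ)

theorem argmaxSet_nonempty {n : ℕ} [NeZero n] (s : Fin n → ℝ) : (argmaxSet s).Nonempty :=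
  Finite.exists_max s

theorem sum_softmax {n : ℕ} [NeZero n] (s : Fin n → ℝ) : ∑ j, softmax s j = 1 := by
  have hZ : 0 < ∑ l, Real.exp (s l) :=
    Finset.sum_pos (fun l _ => Real.exp_pos _) Finset.univ_nonempty
  simp only [softmax, ← Finset.sum_div]
  exact div_self hZ.ne'

theorem ncard_argmaxSet_pos {n : ℕ} [NeZero n] (s : Fin n → ℝ) :
    (0 : ℝ) < (argmaxSet s).ncard := by
  exact_mod_cast (Set.ncard_pos (Set.toFinite _)).2 (argmaxSet_nonempty s)

theorem sum_hardmax {n : ℕ} [NeZero n] (s : Fin n → ℝ) : ∑ j, hardmax s j = 1 := by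
  have hk := ncard_argmaxSet_pos s
  simp only [hardmax, ← Finset.sum_filter, Finset.sum_const, nsmul_eq_mul]
  rw [Set.ncard_eq_toFinset_card'] at *
  have h : (Finset.univ.filter (· ∈ argmaxSet s)) = (argmaxSet s).toFinset := by
    ext; simp
  rw [h]
  exact mul_one_div_cancel hk.ne'

theorem softmax_nonneg {n : ℕ} (s : Fin n → ℝ) (j : Fin n) : 0 ≤ softmax s j :=
  div_nonneg (Real.exp_pos _).le (Finset.sum_nonneg fun _ _ => (Real.exp_pos _).le)

theorem softmax_le_exp_sub {n : ℕ} (s : Fin n → ℝ) (i j : Fin n) :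
    softmax s j ≤ Real.exp (s j - s i) := by
  rw [Real.exp_sub]
  exact div_le_div_of_nonneg_left (Real.exp_pos _).le (Real.exp_pos _)
    (Finset.single_le_sum (f := fun l => Real.exp (s l)) (fun l _ => (Real.exp_pos _).le)
      (Finset.mem_univ i))

theorem eq_of_mem_argmaxSet {n : ℕ} {s : Fin n → ℝ} {i j : Fin n} (hi : i ∈ argmaxSet s)
    (hj : j ∈ argmaxSet s) : s i = s j :=
  le_antisymm (hj i) (hi j)

theorem softmax_le_hardmax {n : ℕ} [NeZero n] {s : Fin n → ℝ} {j : Fin n}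
    (hj : j ∈ argmaxSet s) : softmax s j ≤ hardmax s j := by
  have hk := ncard_argmaxSet_pos s
  have hle : ∑ l ∈ (argmaxSet s).toFinset, softmax s l ≤ ∑ l, softmax s l :=
    Finset.sum_le_sum_of_subset_of_nonneg (Finset.subset_univ _)
      fun l _ _ => softmax_nonneg s l
  have heq : ∑ l ∈ (argmaxSet s).toFinset, softmax s l =
      (argmaxSet s).ncard * softmax s j := by
    rw [Set.ncard_eq_toFinset_card', ← nsmul_eq_mul]
    refine Finset.sum_eq_card_nsmul fun l hl => ?_
    rw [softmax, softmax, eq_of_mem_argmaxSet (Set.mem_toFinset.1 hl) hj]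
  rw [heq, sum_softmax] at hle
  rw [hardmax, if_pos hj, le_div_iff₀ hk, mul_comm]
  exact hle

theorem sum_abs_hardmax_sub_softmax {n : ℕ} [NeZero n] (s : Fin n → ℝ) :
    ∑ j, |hardmax s j - softmax s j| =
      ∑ j, if j ∈ argmaxSet s then 0 else 2 * softmax s j := by
  have h : ∀ j, |hardmax s j - softmax s j| =
      (hardmax s j - softmax s j) + if j ∈ argmaxSet s then 0 else 2 * softmax s j := by
    intro j
    by_cases hj : j ∈ argmaxSet s
    · rw [if_pos hj, add_zero, abs_of_nonneg (sub_nonneg.2 (softmax_le_hardmax hj))]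
    · rw [hardmax, if_neg hj, if_neg hj, zero_sub, abs_neg, abs_of_nonneg (softmax_nonneg s j)]
      ring
  simp only [h, Finset.sum_add_distrib, Finset.sum_sub_distrib, sum_hardmax, sum_softmax,
    sub_self, zero_add]

theorem sepScore_le_sub {n : ℕ} {s : Fin n → ℝ} {i j : Fin n} (hi : i ∈ argmaxSet s)
    (hj : j ∉ argmaxSet s) : sepScore s ≤ s i - s j :=
  sub_le_sub (csInf_le (Set.toFinite _).bddBelow (Set.mem_image_of_mem s hi))
    (le_csSup (Set.toFinite _).bddAbove (Set.mem_image_of_mem s hj))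

/-- `‖hardmax(s) − softmax(s)‖₁ ≤ 2n·e^{−β}` where `β = sep(s)` is the separation
(when the complement of the argmax set is empty, `β = +∞` and the bound is `0`). -/
theorem hardmax_softmax_l1_dist (n : ℕ) (s : Fin n → ℝ) :
    ∑ j, |hardmax s j - softmax s j| ≤
      if ((argmaxSet s)ᶜ : Set (Fin n)).Nonempty
      then 2 * (n : ℝ) * Real.exp (-(sepScore s))
      else 0 := by
  rcases Nat.eq_zero_or_pos n with rfl | hn
  · simp
  have : NeZero n := ⟨hn.ne'⟩
  rw [sum_abs_hardmax_sub_softmax]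
  split_ifs with hne
  · obtain ⟨i, hi⟩ := argmaxSet_nonempty s
    have hterm : ∀ j ∈ Finset.univ, (if j ∈ argmaxSet s then 0 else 2 * softmax s j) ≤
        2 * Real.exp (-(sepScore s)) := by
      intro j _
      split_ifs with hj
      · positivity
      · refine mul_le_mul_of_nonneg_left ((softmax_le_exp_sub s i j).trans ?_) zero_le_two
        exact Real.exp_le_exp.2 (by linarith [sepScore_le_sub hi hj])
    refine (Finset.sum_le_card_nsmul _ _ _ hterm).trans_eq ?_
    rw [Finset.card_fin, nsmul_eq_mul]
    ring
  · refine (Finset.sum_eq_zero fun j _ => if_pos ?_).le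
    by_contra hj
    exact hne ⟨j, hj⟩
end

section
/- Let d ∈ ℕ, let I be a register with |I| = d', let F₁,…,F_m be flags, all pairwise disjoint, let b*_1,…,b*_m ∈ {0,1} and let k ∈ {0,…,d'−1}. Then there exists an MLP f with input dimension d, hidden dimension 2d' and ternary weights such that for all x ∈ {−1,0,1}^d with x[I] = bin_{d'}(p) for some integer 0 ≤ p < 2^{d'} and x[F_j] ∈ {0,1} for all j: (x + f(x))[I] = bin_{d'}(max(0, p − 2^k)) if x[F_j] = b*_j for all j, and (x + f(x))[I] = x[I] otherwise; and all coordinates of x + f(x) at indices not in I equal the corresponding coordinates of x. -/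
/-- A single-hidden-layer ReLU MLP `x ↦ W₂ ReLU(W₁ x + b)` with input/output dimension `d`
and hidden dimension `dff`. -/
structure MLP (d dff : ℕ) where
  W1 : Matrix (Fin dff) (Fin d) ℝ
  b : Fin dff → ℝ
  W2 : Matrix (Fin d) (Fin dff) ℝ

/-- The hidden activations `ReLU(W₁ x + b)` of the MLP. -/
noncomputable def MLP.hidden {d dff : ℕ} (f : MLP d dff) (x : Fin d → ℝ) : Fin dff → ℝ :=
  fun h => max 0 (f.W1.mulVec x h + f.b h)

/-- The output `W₂ ReLU(W₁ x + b)` of the MLP. -/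
noncomputable def MLP.eval {d dff : ℕ} (f : MLP d dff) (x : Fin d → ℝ) : Fin d → ℝ :=
  f.W2.mulVec (f.hidden x)

/-- The MLP has ternary weights: all entries of `W₁` and `W₂` lie in `{-1,0,1}`. -/
def MLP.Ternary {d dff : ℕ} (f : MLP d dff) : Prop :=
  (∀ i j, f.W1 i j = -1 ∨ f.W1 i j = 0 ∨ f.W1 i j = 1) ∧
  (∀ i j, f.W2 i j = -1 ∨ f.W2 i j = 0 ∨ f.W2 i j = 1)

def IsTernary (a : ℝ) : Prop := a = -1 ∨ a = 0 ∨ a = 1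
def IsBit (a : ℝ) : Prop := a = 0 ∨ a = 1
def IsSign (a : ℝ) : Prop := a = -1 ∨ a = 1

/-- The ±1 binary representation of `i` with `r` bits, least significant bit first:
bit `s` is `1` if `⌊i / 2^s⌋` is odd and `-1` otherwise. -/
def binRep (r : ℕ) (i : ℕ) : Fin r → ℝ :=
  fun s => if (i / 2 ^ (s : ℕ)) % 2 = 1 then 1 else -1

theorem Nat.testBit_sub_two_pow_of_lowest {p k r : ℕ} (hkr : k ≤ r) (hr : p.testBit r = true)
    (hlow : ∀ j, k ≤ j → j < r → p.testBit j = false) (t : ℕ) :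
    (p - 2 ^ k).testBit t =
      if k ≤ t ∧ t < r then true else if t = r then false else p.testBit t := by
  obtain ⟨e, rfl⟩ := Nat.exists_eq_add_of_le hkr
  have hl : p % 2 ^ k < 2 ^ k := Nat.mod_lt _ (by positivity)
  have he : 0 < 2 ^ e := by positivity
  have hzero : p / 2 ^ k % 2 ^ e = 0 := by
    apply Nat.eq_of_testBit_eq
    intro j
    rw [Nat.testBit_mod_two_pow, Nat.testBit_div_two_pow, Nat.zero_testBit]
    by_cases hj : j < e
    · simp [hj, hlow (j + k) (by omega) (by omega)]
    · simp [hj]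
  have hodd : p / 2 ^ k / 2 ^ e % 2 = 1 := by
    rw [Nat.div_div_eq_div_mul, ← pow_add]
    simpa [Nat.testBit_eq_decide_div_mod_eq] using hr
  obtain ⟨c, hc⟩ : ∃ c, p / 2 ^ k / 2 ^ e = 2 * c + 1 := ⟨p / 2 ^ k / 2 ^ e / 2, by omega⟩
  have hq : p / 2 ^ k = 2 ^ e * (2 * c + 1) := by
    have := Nat.div_add_mod (p / 2 ^ k) (2 ^ e)
    rw [hc, hzero] at this
    omega
  have hp : p = 2 ^ k * (2 ^ e * (2 * c + 1) + 0) + p % 2 ^ k := by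
    rw [add_zero]
    have := Nat.div_add_mod p (2 ^ k)
    rw [hq] at this
    omega
  have hsub : p - 2 ^ k = 2 ^ k * (2 ^ e * (2 * c) + (2 ^ e - 1)) + p % 2 ^ k := by
    have : 2 ^ e * (2 * c + 1) = 2 ^ e * (2 * c) + (2 ^ e - 1) + 1 := by
      rw [mul_add]; omega
    rw [add_zero, this, mul_add] at hp
    omega
  have hbits := congrArg (Nat.testBit · t) hp
  simp only [Nat.testBit_two_pow_mul_add _ hl, Nat.testBit_two_pow_mul_add _ he] at hbits
  rw [hsub, Nat.testBit_two_pow_mul_add _ hl,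
    Nat.testBit_two_pow_mul_add _ (show 2 ^ e - 1 < 2 ^ e by omega)]
  rw [hbits]
  rcases lt_trichotomy t (k + e) with h | rfl | h
  · by_cases hk : t < k
    · simp [hk, h.ne, hk.not_ge]
    · have : t - k < e := by omega
      simp [hk, this, h, not_lt.mp hk]
  · simp
  · obtain ⟨u, rfl⟩ := Nat.exists_eq_add_of_lt h
    have h1 : ¬ k + e + u + 1 < k := by omega
    have h2 : ¬ k + e + u + 1 - k < e := by omega
    have h3 : k + e + u + 1 - k - e = u + 1 := by omega
    have h4 : (2 * c + 1) / 2 = c := by omega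
    simp [h1, h2, h3, h.not_gt, h.ne', Nat.testBit_add_one, h4]

theorem binRep_eq_testBit (r i : ℕ) (s : Fin r) :
    binRep r i s = if i.testBit s then 1 else -1 := by
  simp [binRep, Nat.testBit_eq_decide_div_mod_eq]

open Classical in
/-- A ReLU unit with unit margin computes a conjunction. -/
theorem relu_sum_add_one_eq_ite {α : Type*} [Fintype α] (P : α → Prop)
    (z : α → ℝ) (h : ∀ a, (P a ∧ z a = 0) ∨ (¬ P a ∧ z a ≤ -1)) :
    max 0 (∑ a, z a + 1) = if ∀ a, P a then 1 else 0 := by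
  split_ifs with hP
  · have : ∀ a, z a = 0 := fun a => ((h a).resolve_right fun h' => h'.1 (hP a)).2
    simp [this]
  · push Not at hP
    obtain ⟨a, ha⟩ := hP
    have hza : z a ≤ -1 := ((h a).resolve_left fun h' => ha h'.1).2
    have hnonpos : ∀ b, z b ≤ 0 := fun b => by
      rcases h b with h' | h' <;> linarith [h'.2]
    have hsplit := Finset.sum_add_sum_compl {a} z
    have hrest := Finset.sum_nonpos fun b (_ : b ∈ ({a} : Finset α)ᶜ) => hnonpos b
    rw [Finset.sum_singleton] at hsplit
    exact max_eq_left (by linarith)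

theorem sum_extend_zero_mul {α β : Type*} [Fintype α] [Fintype β] {φ : α → β}
    (hφ : Function.Injective φ) (u : α → ℝ) (x : β → ℝ) :
    ∑ i, Function.extend φ u 0 i * x i = ∑ a, u a * x (φ a) := by
  refine (Fintype.sum_of_injective φ hφ _ _ (fun i hi => ?_) fun a => ?_).symm
  · rw [Function.extend_apply' _ _ _ (by simpa using hi)]
    simp
  · rw [hφ.extend_apply]

theorem isTernary_extend_zero {α β : Type*} {φ : α → β} (hφ : Function.Injective φ)
    {u : α → ℝ} (hu : ∀ a, IsTernary (u a)) (i : β) :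
    IsTernary (Function.extend φ u 0 i) := by
  by_cases hi : ∃ a, φ a = i
  · obtain ⟨a, rfl⟩ := hi
    rw [hφ.extend_apply]
    exact hu a
  · rw [Function.extend_apply' _ _ _ hi]
    exact Or.inr (Or.inl rfl)

namespace SubtractPow

/-- The positions that must hold `-1` for the unit of position `s` to fire. -/
def Blocks (k s j : ℕ) : Prop := k ≤ j ∧ (j < s ∨ s < k)

instance (k s j : ℕ) : Decidable (Blocks k s j) := inferInstanceAs (Decidable (_ ∧ _))

theorem not_blocks_self (k s : ℕ) : ¬ Blocks k s s := by
  unfold Blocks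
  omega

/-- Input weights of the unit of position `s`. -/
noncomputable def inWeight {d' m : ℕ} (k : ℕ) (bstar : Fin m → ℝ) (s : Fin d') :
    Fin d' ⊕ Fin m → ℝ :=
  Sum.elim (fun t => if t = s then 1 else if Blocks k s t then -1 else 0)
    (fun j => 2 * bstar j - 1)

/-- Largest possible contributions of the inputs to the unit of position `s`. -/
noncomputable def maxContribution {d' m : ℕ} (k : ℕ) (bstar : Fin m → ℝ) (s : Fin d') :
    Fin d' ⊕ Fin m → ℝ :=
  Sum.elim (fun t => if t = s ∨ Blocks k s t then 1 else 0) bstar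

/-- Output weight of the unit of position `s` at position `t`. -/
noncomputable def outWeight {d' : ℕ} (k : ℕ) (t s : Fin d') : ℝ :=
  if t = s then -1 else if k ≤ t.val ∧ t < s then 1 else 0

/-- Subtraction of `2 ^ k`, with two identical units for each position of the register. -/
noncomputable def mlp {d d' m : ℕ} (I : Fin d' → Fin d) (Fl : Fin m → Fin d)
    (bstar : Fin m → ℝ) (k : ℕ) : MLP d (2 * d') where
  W1 := Matrix.of fun h => Function.extend (Sum.elim I Fl)
    (inWeight k bstar (finProdFinEquiv.symm h).2) 0
  b h := 1 - ∑ a, maxContribution (m := m) k bstar (finProdFinEquiv.symm h).2 a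
  W2 := Matrix.of fun i h => Function.extend I
    (fun t => outWeight k t (finProdFinEquiv.symm h).2) 0 i

theorem ternary_mlp {d d' m : ℕ} {I : Fin d' → Fin d} {Fl : Fin m → Fin d}
    (hdisj : Function.Injective (Sum.elim I Fl))
    {bstar : Fin m → ℝ} (hbstar : ∀ j, IsBit (bstar j)) (k : ℕ) :
    (mlp I Fl bstar k).Ternary := by
  refine ⟨fun h i => isTernary_extend_zero hdisj (fun a => ?_) i,
    fun i h => isTernary_extend_zero (φ := I)
      (u := fun t => outWeight k t (finProdFinEquiv.symm h).2)
      (hdisj.comp Sum.inl_injective) (fun t => ?_) i⟩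
  · rcases a with t | j
    · simp only [inWeight, Sum.elim_inl, IsTernary]
      split_ifs <;> simp
    · rcases hbstar j with h | h <;> norm_num [inWeight, IsTernary, h]
  · simp only [outWeight, IsTernary]
    split_ifs <;> simp

/-- The condition under which the units of position `s` fire. -/
def Fires {d d' m : ℕ} (Fl : Fin m → Fin d) (bstar : Fin m → ℝ) (k : ℕ) (x : Fin d → ℝ)
    (p : ℕ) (s : Fin d') : Prop :=
  (p.testBit s = true ∧ ∀ t : Fin d', Blocks k s t → p.testBit t = false) ∧
    ∀ j, x (Fl j) = bstar j

open Classical in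
theorem hidden_mlp {d d' m : ℕ} {I : Fin d' → Fin d} {Fl : Fin m → Fin d}
    (hdisj : Function.Injective (Sum.elim I Fl))
    {bstar : Fin m → ℝ} (hbstar : ∀ j, IsBit (bstar j)) (k : ℕ) {x : Fin d → ℝ} {p : ℕ}
    (hI : ∀ t, x (I t) = binRep d' p t) (hF : ∀ j, IsBit (x (Fl j))) (h : Fin (2 * d')) :
    (mlp I Fl bstar k).hidden x h =
      if Fires Fl bstar k x p (finProdFinEquiv.symm h).2 then 1 else 0 := by
  set s := (finProdFinEquiv.symm h).2 with hs
  have hsum : (mlp I Fl bstar k).W1.mulVec x h + (mlp I Fl bstar k).b h =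
      ∑ a, (inWeight k bstar s a * x (Sum.elim I Fl a) - maxContribution k bstar s a) + 1 := by
    rw [Finset.sum_sub_distrib, ← sum_extend_zero_mul hdisj]
    simp only [mlp, Matrix.mulVec, dotProduct, Matrix.of_apply, ← hs]
    ring
  rw [MLP.hidden, hsum, relu_sum_add_one_eq_ite (Sum.elim
    (fun t : Fin d' => (t = s → p.testBit t = true) ∧ (Blocks k s t → p.testBit t = false))
    (fun j => x (Fl j) = bstar j))]
  · refine if_congr ?_ rfl rfl
    simp only [Sum.forall, Sum.elim_inl, Sum.elim_inr, Fires, forall_and, forall_eq]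
  · rintro (t | j)
    · simp only [inWeight, maxContribution, Sum.elim_inl, hI, binRep_eq_testBit]
      by_cases hts : t = s
      · rw [hts]
        cases hb : p.testBit s <;> norm_num [not_blocks_self, hb]
      · by_cases hB : Blocks k s t
        · cases hb : p.testBit t <;> norm_num [hts, hB]
        · simp [hts, hB]
    · simp only [inWeight, maxContribution, Sum.elim_inr]
      rcases hbstar j with h | h <;> rcases hF j with h' | h' <;> norm_num [h, h']

open Classical in
theorem eval_mlp {d d' m : ℕ} {I : Fin d' → Fin d} {Fl : Fin m → Fin d}
    (hdisj : Function.Injective (Sum.elim I Fl))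
    {bstar : Fin m → ℝ} (hbstar : ∀ j, IsBit (bstar j)) (k : ℕ) {x : Fin d → ℝ} {p : ℕ}
    (hI : ∀ t, x (I t) = binRep d' p t) (hF : ∀ j, IsBit (x (Fl j))) (t : Fin d') :
    (mlp I Fl bstar k).eval x (I t) =
      2 * ∑ s, outWeight k t s * if Fires Fl bstar k x p s then 1 else 0 := by
  have hinj : Function.Injective I := hdisj.comp Sum.inl_injective
  simp only [MLP.eval, Matrix.mulVec, dotProduct, hidden_mlp hdisj hbstar k hI hF]
  simp only [mlp, Matrix.of_apply, hinj.extend_apply]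
  rw [← finProdFinEquiv.sum_comp, Fintype.sum_prod_type]
  simp only [Equiv.symm_apply_apply, Fin.sum_univ_two]
  ring

theorem eval_mlp_of_notMem {d d' m : ℕ} (I : Fin d' → Fin d) (Fl : Fin m → Fin d)
    (bstar : Fin m → ℝ) (k : ℕ) (x : Fin d → ℝ) {i : Fin d} (hi : i ∉ Set.range I) :
    (mlp I Fl bstar k).eval x i = 0 := by
  simp only [MLP.eval, Matrix.mulVec, dotProduct, mlp, Matrix.of_apply]
  refine Finset.sum_eq_zero fun h _ => ?_
  rw [Function.extend_apply' _ _ _ (by simpa using hi)]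
  simp

open Classical in
theorem binRep_add_update {d' : ℕ} (k : ℕ) {p : ℕ} (hp : p < 2 ^ d') (t : Fin d') :
    binRep d' p t + 2 * ∑ s : Fin d', outWeight k t s *
      (if p.testBit s = true ∧ ∀ j : Fin d', Blocks k s j → p.testBit j = false
        then 1 else 0) = binRep d' (p - 2 ^ k) t := by
  by_cases hex : ∃ r, k ≤ r ∧ p.testBit r = true
  · set r := Nat.find hex
    obtain ⟨hkr, hr⟩ : k ≤ r ∧ p.testBit r = true := Nat.find_spec hex
    have hlow : ∀ j, k ≤ j → j < r → p.testBit j = false := fun j hkj hj => by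
      simpa [hkj] using Nat.find_min hex hj
    have hrd : r < d' := by
      by_contra h
      rw [Nat.testBit_lt_two_pow
        (hp.trans_le (Nat.pow_le_pow_right two_pos (not_lt.mp h)))] at hr
      exact Bool.false_ne_true hr
    have hfire : ∀ s : Fin d', (p.testBit s = true ∧
        ∀ j : Fin d', Blocks k s j → p.testBit j = false) ↔ s = ⟨r, hrd⟩ := by
      refine fun s => ⟨fun ⟨hs, hB⟩ => ?_, ?_⟩
      · have hnot : ¬ Blocks k s r := fun h => by simp [hB ⟨r, hrd⟩ h] at hr
        have hge : ¬ (k ≤ s.val ∧ s.val < r) := fun h => by simp [hlow s h.1 h.2] at hs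
        ext
        simp only [Blocks] at hnot ⊢
        omega
      · rintro rfl
        refine ⟨hr, fun j hj => hlow j hj.1 ?_⟩
        simp only [Blocks] at hj
        omega
    simp only [hfire, mul_ite, mul_one, mul_zero, Finset.sum_ite_eq', Finset.mem_univ, if_true]
    simp only [binRep_eq_testBit, Nat.testBit_sub_two_pow_of_lowest hkr hr hlow, outWeight, Fin.ext_iff,
      Fin.lt_def]
    by_cases htr : t.val = r
    · simp [htr, hr]
      norm_num
    · by_cases hk : k ≤ t.val ∧ t.val < r
      · simp [htr, hk, hlow t hk.1 hk.2]
        norm_num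
      · simp [htr, hk]
  · push Not at hex
    have hzero : p - 2 ^ k = 0 := by
      refine Nat.sub_eq_zero_of_le (Nat.lt_pow_two_of_testBit p fun i hi => ?_).le
      simpa using hex i hi
    rw [Finset.sum_eq_single t]
    · by_cases ht : p.testBit t = true
      · have : ∀ j : Fin d', Blocks k t j → p.testBit j = false := fun j hj => by
          simpa using hex j hj.1
        rw [if_pos ⟨ht, this⟩]
        simp [binRep_eq_testBit, hzero, ht, outWeight]
        norm_num
      · simp [binRep_eq_testBit, hzero, ht]
    · intro s _ hst
      by_cases h : k ≤ t.val ∧ t < s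
      · simp [hex s (h.1.trans (Fin.lt_def.mp h.2).le)]
      · simp [outWeight, hst.symm, h]
    · simp

end SubtractPow

/-- In-place power-of-2 subtraction lemma: there is a ternary MLP with hidden dimension
`2d'` such that, on ternary inputs `x` with `x[I] = bin_{d'}(p)` and binary flag values,
the residual update `x + f(x)` holds `bin_{d'}(max(0, p − 2^k))` on `I` if all flags
match the target bits and `x[I]` otherwise, while all coordinates outside `I` are
unmodified. (Here `p - 2^k` is truncated natural subtraction.) -/
theorem subtract_pow2_inplace_mlp (d d' m : ℕ) (I : Fin d' → Fin d) (Fl : Fin m → Fin d)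
    (hdisj : Function.Injective (Sum.elim I Fl))
    (bstar : Fin m → ℝ) (hbstar : ∀ j, IsBit (bstar j))
    (k : ℕ) (hk : k < d') :
    ∃ f : MLP d (2 * d'), f.Ternary ∧
      ∀ x : Fin d → ℝ, (∀ i, IsTernary (x i)) →
        ∀ p : ℕ, p < 2 ^ d' → (∀ t, x (I t) = binRep d' p t) →
        (∀ j, IsBit (x (Fl j))) →
        ((∀ j, x (Fl j) = bstar j) →
          ∀ t, x (I t) + f.eval x (I t) = binRep d' (p - 2 ^ k) t) ∧
        (¬ (∀ j, x (Fl j) = bstar j) →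
          ∀ t, x (I t) + f.eval x (I t) = x (I t)) ∧
        (∀ i, i ∉ Set.range I → x i + f.eval x i = x i) := by
  refine ⟨SubtractPow.mlp I Fl bstar k, SubtractPow.ternary_mlp hdisj hbstar k,
    fun x _ p hp hI hF => ⟨fun hflag t => ?_, fun hflag t => ?_, fun i hi => ?_⟩⟩
  · rw [SubtractPow.eval_mlp hdisj hbstar k hI hF, hI,
      ← SubtractPow.binRep_add_update k hp]
    simp only [SubtractPow.Fires, hflag, implies_true, and_true]
  · rw [SubtractPow.eval_mlp hdisj hbstar k hI hF]
    simp [SubtractPow.Fires, hflag]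
  · rw [SubtractPow.eval_mlp_of_notMem I Fl bstar k x hi, add_zero]
end
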